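/- A nonzero 0/1-valued point v ∈ {0,1}^d is a vertex of the White Whale H_∞^+(d,1) if and only if exactly one coordinate of v is equal to 1; consequently, the only nonzero 0/1-valued canonical vertex of H_∞^+(d,1) is the point (0,…,0,1). -/

import Mathlib

/-- The set `G_d` of generators of the White Whale:
all nonzero 0/1-valued vectors of `ℝ^d`. -/
def whaleGens (d : ℕ) : Set (Fin d → ℝ) :=
  {g | g ≠ 0 ∧ ∀ i, g i = 0 ∨ g i = 1}

/-- The point `p(S)`: the sum of the vectors in `S` (with `p(∅) = 0`). -/
noncomputable def whaleSum {d : ℕ} (S : Set (Fin d → ℝ)) : Fin d → ℝ :=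
  ∑ᶠ g ∈ S, g

/-- The White Whale `H_∞^+(d,1)`: the convex hull of the points `p(S)`
over all subsets `S ⊆ G_d`. -/
noncomputable def whiteWhale (d : ℕ) : Set (Fin d → ℝ) :=
  convexHull ℝ {x | ∃ S : Set (Fin d → ℝ), S ⊆ whaleGens d ∧ x = whaleSum S}

/-- A vertex of the White Whale is an extreme point of it. -/
def IsWhaleVertex (d : ℕ) (x : Fin d → ℝ) : Prop :=
  x ∈ Set.extremePoints ℝ (whiteWhale d)

theorem whaleGens_finite (d : ℕ) : (whaleGens d).Finite := by
  have h : (Set.pi Set.univ fun _ : Fin d => ({0, 1} : Set ℝ)).Finite :=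
    Set.Finite.pi fun _ => Set.toFinite _
  refine h.subset fun g hg i _ => ?_
  simpa using hg.2 i

theorem whaleSum_coe {d : ℕ} (s : Finset (Fin d → ℝ)) :
    whaleSum (s : Set (Fin d → ℝ)) = ∑ g ∈ s, g :=
  finsum_mem_coe_finset _ s

theorem sum_mem_whiteWhale {d : ℕ} {s : Finset (Fin d → ℝ)} (hs : ∀ g ∈ s, g ∈ whaleGens d) :
    ∑ g ∈ s, g ∈ whiteWhale d :=
  subset_convexHull ℝ _ ⟨s, hs, (whaleSum_coe s).symm⟩

theorem single_mem_whaleGens {d : ℕ} (k : Fin d) : Pi.single k (1 : ℝ) ∈ whaleGens d := by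
  refine ⟨by simp, fun i => ?_⟩
  by_cases h : i = k
  · subst h; simp
  · simp [h]

/-- A polyhedron containing the White Whale that has the `k`-th unit vector as a vertex. -/
def whaleBound {d : ℕ} (k : Fin d) : Set (Fin d → ℝ) :=
  {x | (∀ i, 0 ≤ x i) ∧ x k ≤ 1 + ∑ i ∈ Finset.univ.erase k, x i}

theorem convex_whaleBound {d : ℕ} (k : Fin d) : Convex ℝ (whaleBound k) := by
  rintro x ⟨hx, hxk⟩ y ⟨hy, hyk⟩ a b ha hb hab
  refine ⟨fun i => ?_, ?_⟩
  · have h1 := mul_nonneg ha (hx i)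
    have h2 := mul_nonneg hb (hy i)
    simpa using add_nonneg h1 h2
  · have h1 := mul_le_mul_of_nonneg_left hxk ha
    have h2 := mul_le_mul_of_nonneg_left hyk hb
    simp only [Pi.add_apply, Pi.smul_apply, smul_eq_mul, Finset.sum_add_distrib,
      ← Finset.mul_sum]
    linarith

theorem le_of_mem_whaleGens {d : ℕ} (k : Fin d) {g : Fin d → ℝ} (hg : g ∈ whaleGens d) :
    g k ≤ (if g = Pi.single k 1 then 1 else 0) + ∑ i ∈ Finset.univ.erase k, g i := by
  have hnn : ∀ i, 0 ≤ g i := fun i => by rcases hg.2 i with h | h <;> simp [h]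
  have hs : 0 ≤ ∑ i ∈ Finset.univ.erase k, g i := Finset.sum_nonneg fun i _ => hnn i
  rcases hg.2 k with hk | hk
  · rw [hk]; split_ifs <;> linarith
  split_ifs with h
  · linarith
  obtain ⟨i, hik, hi⟩ : ∃ i, i ≠ k ∧ g i = 1 := by
    by_contra! hcon
    refine h (funext fun i => ?_)
    by_cases hik : i = k
    · subst hik; simpa using hk
    · simpa [hik] using (hg.2 i).resolve_right (hcon i hik)
  have := Finset.single_le_sum (f := g) (fun i _ => hnn i)
    (Finset.mem_erase.2 ⟨hik, Finset.mem_univ i⟩)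
  linarith

theorem whiteWhale_subset_whaleBound {d : ℕ} (k : Fin d) : whiteWhale d ⊆ whaleBound k := by
  refine convexHull_min ?_ (convex_whaleBound k)
  rintro _ ⟨S, hS, rfl⟩
  lift S to Finset (Fin d → ℝ) using (whaleGens_finite d).subset hS
  rw [whaleSum_coe]
  refine ⟨fun i => ?_, ?_⟩
  · rw [Finset.sum_apply]
    refine Finset.sum_nonneg fun g hg => ?_
    rcases (hS hg).2 i with h | h <;> simp [h]
  · have h := Finset.sum_le_sum fun g (hg : g ∈ S) => le_of_mem_whaleGens k (hS hg)
    rw [Finset.sum_add_distrib, Finset.sum_comm, Finset.sum_ite_eq'] at h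
    simp only [Finset.sum_apply]
    split_ifs at h <;> linarith

theorem single_mem_extremePoints_whaleBound {d : ℕ} (k : Fin d) :
    Pi.single k (1 : ℝ) ∈ Set.extremePoints ℝ (whaleBound k) := by
  refine ⟨⟨fun i => ?_, ?_⟩, ?_⟩
  · rcases (single_mem_whaleGens k).2 i with h | h <;> simp [h]
  · simp
  · rintro x ⟨hx, hxk⟩ y ⟨hy, hyk⟩ ⟨a, b, ha, hb, hab, h⟩
    have hcoord : ∀ i, a * x i + b * y i = (Pi.single k (1 : ℝ) : Fin d → ℝ) i :=
      fun i => by simpa using congrFun h i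
    have hz : ∀ i, i ≠ k → x i = 0 ∧ y i = 0 := fun i hi => by
      have h0 := hcoord i
      rw [Pi.single_eq_of_ne hi] at h0
      have h1 := mul_nonneg ha.le (hx i)
      have h2 := mul_nonneg hb.le (hy i)
      exact ⟨(mul_eq_zero.1 (by linarith : a * x i = 0)).resolve_left ha.ne',
        (mul_eq_zero.1 (by linarith : b * y i = 0)).resolve_left hb.ne'⟩
    rw [Finset.sum_eq_zero fun i hi => (hz i (Finset.ne_of_mem_erase hi)).1] at hxk
    rw [Finset.sum_eq_zero fun i hi => (hz i (Finset.ne_of_mem_erase hi)).2] at hyk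
    have hk := hcoord k
    rw [Pi.single_eq_same] at hk
    have hxk1 : x k = 1 := by nlinarith
    funext i
    by_cases hi : i = k
    · subst hi; simpa using hxk1
    · simpa [hi] using (hz i hi).1

theorem isWhaleVertex_single {d : ℕ} (k : Fin d) : IsWhaleVertex d (Pi.single k 1) := by
  refine inter_extremePoints_subset_extremePoints_of_subset (whiteWhale_subset_whaleBound k)
    ⟨?_, single_mem_extremePoints_whaleBound k⟩
  have h := sum_mem_whiteWhale (s := {Pi.single k 1}) (by simpa using single_mem_whaleGens k)
  rwa [Finset.sum_singleton] at h

theorem zero_mem_whiteWhale (d : ℕ) : (0 : Fin d → ℝ) ∈ whiteWhale d := by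
  have h := sum_mem_whiteWhale (d := d) (s := ∅) (by simp)
  rwa [Finset.sum_empty] at h

/-- A generator with at least two ones splits off a unit vector, so its double is a sum of
three distinct generators. -/
theorem add_self_mem_whiteWhale {d : ℕ} {v : Fin d → ℝ} (hv : v ∈ whaleGens d) {i j : Fin d}
    (hij : i ≠ j) (hi : v i = 1) (hj : v j = 1) : v + v ∈ whiteWhale d := by
  set e : Fin d → ℝ := Pi.single i 1 with he
  have hei : e i = 1 := by simp [he]
  have hej : e j = 0 := by simp [he, hij.symm]
  have hne1 : v ≠ e := fun h => by simpa [hj, hej] using congrFun h j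
  have hne2 : v ≠ v - e := fun h => by simpa [hi, hei] using congrFun h i
  have hne3 : e ≠ v - e := fun h => by simpa [hi, hei] using congrFun h i
  have hgen : v - e ∈ whaleGens d := by
    refine ⟨sub_ne_zero.2 hne1, fun l => ?_⟩
    by_cases hl : l = i
    · subst hl; simp [hi, hei]
    · simpa [he, hl] using hv.2 l
  have h := sum_mem_whiteWhale (s := {v, e, v - e}) (by
    intro g hg
    simp only [Finset.mem_insert, Finset.mem_singleton] at hg
    rcases hg with rfl | rfl | rfl
    exacts [hv, single_mem_whaleGens i, hgen])
  rw [Finset.sum_insert (by simp [hne1, hne2]), Finset.sum_pair hne3] at h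
  simpa using h

theorem IsWhaleVertex.exists_setOf_eq_one_eq_singleton {d : ℕ} {v : Fin d → ℝ} (hv : v ∈ whaleGens d)
    (h : IsWhaleVertex d v) : ∃ k, {i : Fin d | v i = 1} = {k} := by
  obtain ⟨k, hk⟩ : ∃ k, v k = 1 := by
    by_contra! hcon
    exact hv.1 (funext fun i => (hv.2 i).resolve_right (hcon i))
  refine ⟨k, Set.eq_singleton_iff_unique_mem.2 ⟨hk, fun i hi => ?_⟩⟩
  by_contra hik
  have hseg : v ∈ openSegment ℝ (0 : Fin d → ℝ) (v + v) := by
    refine ⟨1 / 2, 1 / 2, by norm_num, by norm_num, by norm_num, funext fun l => ?_⟩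
    simp only [Pi.add_apply, Pi.smul_apply, Pi.zero_apply, smul_eq_mul]
    ring
  exact hv.1 (h.2 (zero_mem_whiteWhale d) (add_self_mem_whiteWhale hv hik hi hk) hseg).symm

theorem eq_single_of_setOf_eq_one {d : ℕ} {v : Fin d → ℝ} (hv : ∀ i, v i = 0 ∨ v i = 1)
    {k : Fin d} (hk : {i : Fin d | v i = 1} = {k}) : v = Pi.single k 1 := by
  have hiff : ∀ i, v i = 1 ↔ i = k := fun i => by simpa using Set.ext_iff.1 hk i
  funext i
  by_cases hi : i = k
  · subst hi; simpa using hiff i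
  · simpa [hi] using (hv i).resolve_right (mt (hiff i).1 hi)

/-- A nonzero 0/1-valued point is a vertex of the White Whale if and only if
exactly one of its coordinates equals 1; consequently, the only nonzero
0/1-valued canonical vertex is (0,…,0,1). -/
theorem whaleVertex_of_zeroOne (d : ℕ) (hd : 1 ≤ d) :
    (∀ v : Fin d → ℝ, v ≠ 0 → (∀ i, v i = 0 ∨ v i = 1) →
      (IsWhaleVertex d v ↔ {i : Fin d | v i = 1}.ncard = 1)) ∧
    (∀ v : Fin d → ℝ, v ≠ 0 → (∀ i, v i = 0 ∨ v i = 1) →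
      IsWhaleVertex d v → Monotone v →
      v = fun i : Fin d => if (i : ℕ) = d - 1 then 1 else 0) := by
  refine ⟨fun v hv0 hv => ⟨fun h => ?_, fun h => ?_⟩, fun v hv0 hv h hmono => ?_⟩
  · exact Set.ncard_eq_one.2 (h.exists_setOf_eq_one_eq_singleton ⟨hv0, hv⟩)
  · obtain ⟨k, hk⟩ := Set.ncard_eq_one.1 h
    rw [eq_single_of_setOf_eq_one hv hk]
    exact isWhaleVertex_single k
  · obtain ⟨k, hk⟩ := h.exists_setOf_eq_one_eq_singleton ⟨hv0, hv⟩
    have hvk := eq_single_of_setOf_eq_one hv hk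
    have hlast : (k : ℕ) = d - 1 := by
      have hle : k ≤ ⟨d - 1, by omega⟩ := Fin.mk_le_mk.2 (by omega)
      have h1 := hmono hle
      rw [hvk, Pi.single_eq_same, Pi.single_apply] at h1
      split_ifs at h1 with h2
      · rw [← h2]
      · norm_num at h1
    rw [hvk]
    funext i
    rw [Pi.single_apply]
    simp only [Fin.ext_iff, hlast]
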